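/- (Cyclotomic divisibility of Ω_{r,n}.) Let p be a prime, r ≥ 1, and 0 ≤ n ≤ p^{2r} − 1. Then in the ring ℤ[q, q⁻¹] of Laurent polynomials, the product ∏_{j=r}^{2r−1} Φ_{p^j}(q)^{⌊n/p^j⌋} divides Ω_{r,n}(q), where Φ_{p^j}(q) ∈ ℤ[q] is the p^j-th cyclotomic polynomial. -/

import Mathlib

/-- The `q`-Pochhammer symbol `(q;q)_n = ∏_{k=1}^n (1 - q^k)` in `ℤ[q]`. -/
noncomputable def qPoch (n : ℕ) : Polynomial ℤ :=
  ∏ i ∈ Finset.range n, (1 - Polynomial.X ^ (i + 1))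

open Polynomial in
theorem qPoch_succ (n : ℕ) : qPoch (n + 1) = qPoch n * (1 - X ^ (n + 1)) := by
  simp [qPoch, Finset.prod_range_succ]

open Polynomial in
theorem qPoch_ne_zero (n : ℕ) : qPoch n ≠ 0 := by
  refine Finset.prod_ne_zero_iff.mpr fun i _ h => ?_
  have := congrArg (eval 0) h
  simp at this

section GaussianBinomial

open Polynomial

variable {B : ℕ → ℕ → ℤ[X]}

theorem gaussBinom_zero_right (hB1 : ∀ n k : ℕ, k ≤ n → B n k * (qPoch k * qPoch (n - k)) = qPoch n)
    (n : ℕ) : B n 0 = 1 := by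
  have h := hB1 n 0 (Nat.zero_le n)
  refine mul_right_cancel₀ (qPoch_ne_zero n) ?_
  simpa [qPoch] using h

theorem gaussBinom_self (hB1 : ∀ n k : ℕ, k ≤ n → B n k * (qPoch k * qPoch (n - k)) = qPoch n)
    (n : ℕ) : B n n = 1 := by
  have h := hB1 n n le_rfl
  refine mul_right_cancel₀ (qPoch_ne_zero n) ?_
  simpa [qPoch] using h

theorem gaussBinom_succ_succ (hB0 : ∀ n k : ℕ, n < k → B n k = 0)
    (hB1 : ∀ n k : ℕ, k ≤ n → B n k * (qPoch k * qPoch (n - k)) = qPoch n) {n k : ℕ} (hk : k ≤ n) :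
    B (n + 1) (k + 1) = B n k + X ^ (k + 1) * B n (k + 1) := by
  obtain rfl | hlt := hk.eq_or_lt
  · rw [gaussBinom_self hB1, gaussBinom_self hB1, hB0 _ _ (Nat.lt_succ_self k)]
    simp
  obtain ⟨d, rfl⟩ := Nat.exists_eq_add_of_lt hlt
  have h1 := hB1 (k + d + 1 + 1) (k + 1) (by omega)
  have h2 := hB1 (k + d + 1) k (by omega)
  have h3 := hB1 (k + d + 1) (k + 1) (by omega)
  rw [show k + d + 1 + 1 - (k + 1) = d + 1 by omega, qPoch_succ (k + d + 1)] at h1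
  rw [show k + d + 1 - k = d + 1 by omega] at h2
  rw [show k + d + 1 - (k + 1) = d by omega] at h3
  refine mul_right_cancel₀ (mul_ne_zero (qPoch_ne_zero (k + 1)) (qPoch_ne_zero (d + 1))) ?_
  rw [h1, ← sub_eq_zero]
  rw [qPoch_succ k] at h3 ⊢
  rw [qPoch_succ d] at h2 ⊢
  linear_combination (-(1 - X ^ (k + 1))) * h2 - X ^ (k + 1) * (1 - X ^ (d + 1)) * h3

/-- The finite `q`-binomial theorem. -/
theorem prod_X_pow_sub_C_eq_sum {R : Type*} [CommRing R] (hB0 : ∀ n k : ℕ, n < k → B n k = 0)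
    (hB1 : ∀ n k : ℕ, k ≤ n → B n k * (qPoch k * qPoch (n - k)) = qPoch n) (z : R) (n : ℕ) :
    ∏ i ∈ Finset.range n, ((X : R[X]) ^ i - C z) =
      ∑ m ∈ Finset.range (n + 1),
        C z ^ m * ((-1) ^ m * X ^ (n - m).choose 2 * (B n m).map (Int.castRingHom R)) := by
  induction n with
  | zero => simp [gaussBinom_self hB1]
  | succ n ih =>
    have hlast : ∑ m ∈ Finset.range (n + 1), C z ^ m *
          ((-1) ^ m * X ^ (n - m).choose 2 * (B n m).map (Int.castRingHom R)) =
        ∑ m ∈ Finset.range (n + 2), C z ^ m *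
          ((-1) ^ m * X ^ (n - m).choose 2 * (B n m).map (Int.castRingHom R)) := by
      rw [Finset.sum_range_succ _ (n + 1), hB0 n (n + 1) (Nat.lt_succ_self n)]
      simp
    rw [Finset.prod_range_succ, mul_comm, sub_mul]
    nth_rewrite 1 [ih, hlast]
    rw [ih, Finset.sum_range_succ' _ (n + 1), Finset.sum_range_succ' _ (n + 1), mul_add,
      Finset.mul_sum, Finset.mul_sum, add_sub_right_comm, ← Finset.sum_sub_distrib]
    congr 1
    · refine Finset.sum_congr rfl fun m hm => ?_
      have hmn : m ≤ n := Nat.lt_succ_iff.mp (Finset.mem_range.mp hm)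
      rw [gaussBinom_succ_succ hB0 hB1 hmn, Nat.add_sub_add_right]
      obtain rfl | hlt := hmn.eq_or_lt
      · simp [hB0 m (m + 1) (Nat.lt_succ_self m)]
        ring
      obtain ⟨d, rfl⟩ := Nat.exists_eq_add_of_lt hlt
      rw [show m + d + 1 - m = d + 1 by omega, show m + d + 1 - (m + 1) = d by omega,
        Nat.choose_succ_succ' d 1, Nat.choose_one_right]
      simp only [Polynomial.map_add, Polynomial.map_mul, Polynomial.map_pow, map_X]
      ring
    · rw [gaussBinom_zero_right hB1, gaussBinom_zero_right hB1, Nat.sub_zero, Nat.sub_zero,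
        Nat.choose_succ_succ' n 1, Nat.choose_one_right]
      simp [pow_add]

end GaussianBinomial

section Cyclotomic

open Polynomial

variable {K : Type*} [Field K]

theorem cyclotomic_dvd_prod_X_pow_add_sub_C {N : ℕ} (hN : 0 < N) {μ z : K}
    (hμ : IsPrimitiveRoot μ N) (hz : z ^ N = 1) {a : ℕ} (ha : N ∣ a) :
    cyclotomic N K ∣ ∏ i ∈ Finset.range N, (X ^ (a + i) - C z) := by
  rw [cyclotomic_eq_prod_X_sub_primitiveRoots hμ]
  refine Finset.prod_dvd_of_coprime
    (fun x _ y _ hxy => pairwise_coprime_X_sub_C Function.injective_id hxy) fun ω hω => ?_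
  have hω' := (mem_primitiveRoots hN).mp hω
  have : NeZero N := ⟨hN.ne'⟩
  obtain ⟨i, hi, rfl⟩ := hω'.eq_pow_of_pow_eq_one hz
  refine dvd_trans ?_ (Finset.dvd_prod_of_mem _ (Finset.mem_range.mpr hi))
  rw [dvd_iff_isRoot]
  simp [pow_add, (hω'.pow_eq_one_iff_dvd a).mpr ha]

theorem cyclotomic_pow_dvd_prod_X_pow_sub_C {N : ℕ} (hN : 0 < N) {μ z : K}
    (hμ : IsPrimitiveRoot μ N) (hz : z ^ N = 1) (n : ℕ) :
    cyclotomic N K ^ (n / N) ∣ ∏ i ∈ Finset.range n, (X ^ i - C z) := by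
  have key (e : ℕ) : cyclotomic N K ^ e ∣ ∏ i ∈ Finset.range (e * N), (X ^ i - C z) := by
    induction e with
    | zero => simp
    | succ e ih =>
      rw [pow_succ, Nat.succ_mul, Finset.prod_range_add]
      exact mul_dvd_mul ih
        (cyclotomic_dvd_prod_X_pow_add_sub_C hN hμ hz (Dvd.intro_left e rfl))
  exact (key _).trans (Finset.prod_dvd_prod_of_subset _ _ _
    (Finset.range_mono (Nat.div_mul_le_self n N)))

theorem isCoprime_cyclotomic [CharZero K] {a b : ℕ} (hab : a ≠ b) :
    IsCoprime (cyclotomic a K) (cyclotomic b K) := by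
  have h := (cyclotomic.isCoprime_rat hab).map (mapRingHom (algebraMap ℚ K))
  simpa using h

end Cyclotomic

/-- Orthogonality of the characters of `ℤ/Nℤ`, as a sieve for multiples of `N` in a sum. -/
theorem IsPrimitiveRoot.sum_sum_pow_mul {R A : Type*} [CommRing R] [IsDomain R] [CommRing A]
    (f : R →+* A) {ζ : R} {N : ℕ} (hN : 0 < N) (hζ : IsPrimitiveRoot ζ N) (n : ℕ) (c : ℕ → A) :
    ∑ t ∈ Finset.range N, ∑ m ∈ Finset.range (n + 1), f (ζ ^ t) ^ m * c m =
      N * ∑ k ∈ Finset.range (n / N + 1), c (k * N) := by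
  have hsum (m : ℕ) : ∑ t ∈ Finset.range N, f (ζ ^ t) ^ m = if N ∣ m then (N : A) else 0 := by
    have hpow (t : ℕ) : f (ζ ^ t) ^ m = f ((ζ ^ m) ^ t) := by
      rw [← map_pow, ← pow_mul, ← pow_mul, mul_comm]
    simp only [hpow, ← map_sum]
    split_ifs with h
    · simp [(hζ.pow_eq_one_iff_dvd m).mpr h]
    · have h1 : ζ ^ m - 1 ≠ 0 := fun h0 =>
        h ((hζ.pow_eq_one_iff_dvd m).mp (sub_eq_zero.mp h0))
      have h2 : (∑ t ∈ Finset.range N, (ζ ^ m) ^ t) * (ζ ^ m - 1) = 0 := by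
        rw [geom_sum_mul, ← pow_mul, mul_comm, pow_mul, hζ.pow_eq_one, one_pow, sub_self]
      rw [(mul_eq_zero.mp h2).resolve_right h1, map_zero]
  rw [Finset.sum_comm]
  simp only [← Finset.sum_mul, hsum, ite_mul, zero_mul]
  rw [← Finset.sum_filter, Finset.mul_sum]
  symm
  refine Finset.sum_nbij (fun k => k * N) (fun k hk => ?_) (fun a _ b _ h => ?_)
    (fun m hm => ?_) (fun _ _ => rfl)
  · have hk' : k ≤ n / N := Nat.lt_succ_iff.mp (Finset.mem_range.mp hk)
    exact Finset.mem_filter.mpr ⟨Finset.mem_range.mpr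
      (Nat.lt_succ_of_le ((Nat.le_div_iff_mul_le hN).mp hk')), Dvd.intro_left k rfl⟩
  · exact Nat.eq_of_mul_eq_mul_right hN h
  · obtain ⟨hm1, k, rfl⟩ := Finset.mem_filter.mp hm
    have hm2 : N * k ≤ n := Nat.lt_succ_iff.mp (Finset.mem_range.mp hm1)
    refine ⟨k, Finset.mem_coe.mpr (Finset.mem_range.mpr (Nat.lt_succ_of_le
      ((Nat.le_div_iff_mul_le hN).mpr (by rwa [mul_comm])))), mul_comm _ _⟩

open Polynomial in
theorem prod_cyclotomic_pow_dvd_sum_gaussBinom {B : ℕ → ℕ → ℤ[X]}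
    (hB0 : ∀ n k : ℕ, n < k → B n k = 0)
    (hB1 : ∀ n k : ℕ, k ≤ n → B n k * (qPoch k * qPoch (n - k)) = qPoch n)
    {p : ℕ} (hp : p.Prime) (r s n : ℕ) :
    ∏ j ∈ Finset.Ico r s, cyclotomic (p ^ j) ℤ ^ (n / p ^ j) ∣
      ∑ k ∈ Finset.range (n / p ^ r + 1),
        (-1) ^ (k * p ^ r) * X ^ (n - k * p ^ r).choose 2 * B n (k * p ^ r) := by
  have hpos (j : ℕ) : 0 < p ^ j := pow_pos hp.pos j
  have hmonic : (∏ j ∈ Finset.Ico r s, cyclotomic (p ^ j) ℤ ^ (n / p ^ j)).Monic :=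
    monic_prod_of_monic _ _ fun j _ => (cyclotomic.monic _ ℤ).pow _
  rw [← map_dvd_map (Int.castRingHom ℂ) Int.cast_injective hmonic]
  have hζ := Complex.isPrimitiveRoot_exp (p ^ r) (hpos r).ne'
  set ζ := Complex.exp (2 * Real.pi * Complex.I / (p ^ r : ℕ))
  have hunit : IsUnit ((p ^ r : ℕ) : ℂ[X]) := by
    rw [← C_eq_natCast, isUnit_C, isUnit_iff_ne_zero, Nat.cast_ne_zero]
    exact (hpos r).ne'
  refine (hunit.dvd_mul_left).mp ?_
  have horth := hζ.sum_sum_pow_mul C (hpos r) n fun m =>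
    (-1) ^ m * X ^ (n - m).choose 2 * (B n m).map (Int.castRingHom ℂ)
  simp only [← prod_X_pow_sub_C_eq_sum hB0 hB1] at horth
  simp only [Polynomial.map_sum, Polynomial.map_prod, Polynomial.map_mul, Polynomial.map_pow,
    Polynomial.map_neg, Polynomial.map_one, map_X, map_cyclotomic]
  rw [← horth]
  refine Finset.dvd_sum fun t _ => Finset.prod_dvd_of_coprime (fun i _ j _ hij => ?_)
    fun j hj => ?_
  · exact (isCoprime_cyclotomic fun h => hij (Nat.pow_right_injective hp.two_le h)).pow
  · refine cyclotomic_pow_dvd_prod_X_pow_sub_C (hpos j)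
      (Complex.isPrimitiveRoot_exp (p ^ j) (hpos j).ne') ?_ n
    rw [← pow_mul, mul_comm, pow_mul,
      (hζ.pow_eq_one_iff_dvd _).mpr (pow_dvd_pow p (Finset.mem_Ico.mp hj).1), one_pow]

theorem Nat.cast_choose_two_add_choose_succ_two {n m : ℕ} (h : m ≤ n) :
    (n.choose 2 : ℤ) + ((m + 1).choose 2 - n * m) = (n - m).choose 2 := by
  obtain ⟨d, rfl⟩ := Nat.exists_eq_add_of_le h
  rw [Nat.add_sub_cancel_left]
  have hc (a : ℕ) : (2 : ℚ) * (a.choose 2 : ℚ) = a * (a - 1) := by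
    rw [Nat.cast_choose_two]; ring
  have h1 := hc (m + d)
  have h2 := hc (m + 1)
  have h3 := hc d
  have : ((m + d).choose 2 : ℚ) + ((m + 1).choose 2 - ((m + d : ℕ) : ℚ) * m) = d.choose 2 := by
    push_cast at h1 h2 ⊢
    linarith
  exact_mod_cast this

/-- **Cyclotomic divisibility of `Ω_{r,n}(q)`** (Ophir–de Shalit, Lemma 12; Pan, Thm 1.1):
in `ℤ[q,q⁻¹]`, `∏_{j=r}^{2r−1} Φ_{p^j}(q)^{⌊n/p^j⌋}` divides
`Ω_{r,n}(q) = Σ_{k=0}^{⌊n/p^r⌋} (−1)^{k p^r} q^{(kp^r)(kp^r+1)/2 − n k p^r} [n choose kp^r]_q`.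
Here `B` is the Gaussian binomial coefficient `[n choose k]_q ∈ ℤ[q]`, characterized by
`[n choose k]_q (q;q)_k (q;q)_{n−k} = (q;q)_n` for `k ≤ n` and `[n choose k]_q = 0` for `k > n`. -/
theorem stmt_15 (p : ℕ) (hp : p.Prime) (r : ℕ) (hr : 1 ≤ r) (n : ℕ) (hn : n ≤ p ^ (2 * r) - 1)
    (B : ℕ → ℕ → Polynomial ℤ)
    (hB0 : ∀ n k : ℕ, n < k → B n k = 0)
    (hB1 : ∀ n k : ℕ, k ≤ n → B n k * (qPoch k * qPoch (n - k)) = qPoch n) :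
    (∏ j ∈ Finset.Ico r (2 * r),
        Polynomial.toLaurent (Polynomial.cyclotomic (p ^ j) ℤ) ^ (n / p ^ j))
      ∣ ∑ k ∈ Finset.range (n / p ^ r + 1),
          (-1) ^ (k * p ^ r) *
            LaurentPolynomial.T (((k * p ^ r + 1).choose 2 : ℤ) - (n * k * p ^ r : ℤ)) *
            Polynomial.toLaurent (B n (k * p ^ r)) := by
  have hdvd := map_dvd Polynomial.toLaurent
    (prod_cyclotomic_pow_dvd_sum_gaussBinom hB0 hB1 hp r (2 * r) n)
  simp only [map_prod, map_sum, map_mul, map_pow, map_neg, map_one] at hdvd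
  refine ((LaurentPolynomial.isUnit_T (n.choose 2 : ℤ)).dvd_mul_left).mp ?_
  refine hdvd.trans (dvd_of_eq ?_)
  rw [Finset.mul_sum]
  refine Finset.sum_congr rfl fun k hk => ?_
  have hk' : k * p ^ r ≤ n :=
    (Nat.le_div_iff_mul_le (pow_pos hp.pos r)).mp (Nat.lt_succ_iff.mp (Finset.mem_range.mp hk))
  have hexp := Nat.cast_choose_two_add_choose_succ_two hk'
  rw [Nat.cast_mul, Nat.cast_pow, ← mul_assoc] at hexp
  rw [Polynomial.toLaurent_X, LaurentPolynomial.T_pow, mul_one, ← hexp, LaurentPolynomial.T_add]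
  ring
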